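/- arXiv:1611.02251 — 2 statements merged into one kernel-verified Lean document; each statement's English description precedes it below -/
import Mathlib

section
/- Let m ≥ 1, let u be a λ-eigenfunction of −Δ_m, and let λ' be a real number with λ' ∉ {1,3} and R(λ') = λ. Then the λ'-extension ũ of u is a λ'-eigenfunction of −Δ_{m+1}; in particular ũ is a well-defined nonzero function on K_{m+1} and −Δ_{m+1} ũ = λ' ũ. -/
open scoped BigOperators

noncomputable section

namespace VNLE

/-- `N_m = 2·5^m`, the number of points on the circle at level `m`. -/
def Nm (m : ℕ) : ℕ := 2 * 5 ^ m

/-- The partner of a vertex `n` of `K_m`: writing the representative `v` of `n`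
(taking `v = 2·5^m` when `n = 0`) as `v = 5^k·a` with `5 ∤ a`, the partner is
`n + 5^k` if `a ≡ 1` or `3 (mod 5)`, and `n - 5^k` if `a ≡ 2` or `4 (mod 5)`.
This realizes the identifications `5^k(1+5j) ∼ 5^k(2+5j)` and
`5^k(3+5j) ∼ 5^k(4+5j)` in `ℤ/(2·5^m)ℤ`. -/
def partner (m : ℕ) (n : ZMod (Nm m)) : ZMod (Nm m) :=
  let v : ℕ := if n.val = 0 then Nm m else n.val
  let k : ℕ := padicValNat 5 v
  if (v / 5 ^ k) % 5 = 1 ∨ (v / 5 ^ k) % 5 = 3 then n + ((5 ^ k : ℕ) : ZMod (Nm m))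
  else n - ((5 ^ k : ℕ) : ZMod (Nm m))

/-- A function on `K_m`: a map on `ℤ/N_mℤ` constant on the identified pairs. -/
def IsKFun (m : ℕ) (u : ZMod (Nm m) → ℝ) : Prop := ∀ n, u (partner m n) = u n

/-- The graph Laplacian `−Δ_m`. -/
def lap (m : ℕ) (u : ZMod (Nm m) → ℝ) : ZMod (Nm m) → ℝ := fun n =>
  4 * u n - u (n + 1) - u (n - 1) - u (partner m n + 1) - u (partner m n - 1)

/-- `u` is a `λ`-eigenfunction of `−Δ_m`. -/
def IsEigen (m : ℕ) (lam : ℝ) (u : ZMod (Nm m) → ℝ) : Prop :=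
  IsKFun m u ∧ u ≠ 0 ∧ ∀ n, lap m u n = lam * u n

/-- The spectral decimation renormalization polynomial `R(x) = x(3−x)(5−x)`. -/
def R (x : ℝ) : ℝ := x * (3 - x) * (5 - x)

/-- The `λ'`-extension of a function on `K_m` to a function on `K_{m+1}`. -/
def extFun (m : ℕ) (lam' : ℝ) (u : ZMod (Nm m) → ℝ) : ZMod (Nm (m + 1)) → ℝ := fun x =>
  let n : ZMod (Nm m) := ((x.val / 5 : ℕ) : ZMod (Nm m))
  if x.val % 5 = 0 then u n
  else if x.val % 5 = 1 ∨ x.val % 5 = 2 then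
    ((2 - lam') * u n + u (n + 1)) / ((1 - lam') * (3 - lam'))
  else
    (u n + (2 - lam') * u (n + 1)) / ((1 - lam') * (3 - lam'))

/-- Restriction of a function on `K_{m+1}` to the old vertices, giving a function on `K_m`. -/
def down (m : ℕ) (v : ZMod (Nm (m + 1)) → ℝ) : ZMod (Nm m) → ℝ := fun n =>
  v (((5 * n.val : ℕ) : ZMod (Nm (m + 1))))

/-- The Laplacian `−Δ_m` as a linear map. -/
def lapL (m : ℕ) : (ZMod (Nm m) → ℝ) →ₗ[ℝ] (ZMod (Nm m) → ℝ) where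
  toFun := lap m
  map_add' u v := by funext n; simp only [lap, Pi.add_apply]; ring
  map_smul' c u := by funext n; simp only [lap, Pi.smul_apply, smul_eq_mul, RingHom.id_apply]; ring

/-- The subspace of functions on `K_m` (maps constant on identified pairs). -/
def KFunSub (m : ℕ) : Submodule ℝ (ZMod (Nm m) → ℝ) where
  carrier := {u | IsKFun m u}
  add_mem' := by
    intro u v hu hv n
    simp only [Pi.add_apply, hu n, hv n]
  zero_mem' := fun _ => rfl
  smul_mem' := by
    intro c u hu n
    simp only [Pi.smul_apply, hu n]

/-- The `λ`-eigenspace of `−Δ_m` inside the space of functions on `K_m`. -/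
def eigensp (m : ℕ) (lam : ℝ) : Submodule ℝ (ZMod (Nm m) → ℝ) :=
  LinearMap.ker (lapL m - lam • LinearMap.id) ⊓ KFunSub m

/-- `c = (8 − √19)/3`, the smaller critical point of `R`. -/
def cpt : ℝ := (8 - Real.sqrt 19) / 3

/-- `φ₁`, the inverse of the (strictly increasing) restriction of `R` to `[0, c]`. -/
def phi1 : ℝ → ℝ := Function.invFunOn R (Set.Icc 0 cpt)

/-- Eigenvalue counting function: total dimension of the eigenspaces of `−Δ_m`
with eigenvalue `≤ t`. -/
def evCount (m : ℕ) (t : ℝ) : ℕ :=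
  Module.finrank ℝ ↥(⨆ lam ∈ Set.Iic t, eigensp m lam)

/-- `evSorted m k = λ_k(m)`, the `k`-th smallest eigenvalue (with multiplicity,
`1 ≤ k ≤ 5^m`) of `−Δ_m` acting on functions on `K_m`. -/
def evSorted (m k : ℕ) : ℝ := sInf {t : ℝ | k ≤ evCount m t}

/-- The restriction of a function on the circle `ℝ/ℤ` to the level-`m` vertices. -/
def restr (u : AddCircle (1 : ℝ) → ℝ) (m : ℕ) : ZMod (Nm m) → ℝ := fun n =>
  u (((n.val : ℝ) / (Nm m : ℝ) : ℝ) : AddCircle (1 : ℝ))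

/-- A continuous function on the circle is admissible if at every level its values
agree on identified pairs, so that its restrictions are functions on `K_m`. -/
def Admissible (u : AddCircle (1 : ℝ) → ℝ) : Prop :=
  Continuous u ∧ ∀ m, 1 ≤ m → ∀ n : ZMod (Nm m), restr u m (partner m n) = restr u m n

/-- `u` is a `λ`-eigenfunction of `−Δ` on `K`: it is admissible, nonzero, and
`sup_n |15^m (−Δ_m u_m)(n) − λ u(n/N_m)| → 0` as `m → ∞`. -/
def IsEigenK (lam : ℝ) (u : AddCircle (1 : ℝ) → ℝ) : Prop :=
  Admissible u ∧ u ≠ 0 ∧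
    ∀ ε : ℝ, 0 < ε → ∃ M : ℕ, ∀ m, M ≤ m → ∀ n : ZMod (Nm m),
      |(15 : ℝ) ^ m * lap m (restr u m) n - lam * restr u m n| < ε

/-- The symmetry-type subspace `V_{ε₁,ε₂}` of functions on `K_m`. -/
def symSub (m : ℕ) (e1 e2 : ℝ) : Submodule ℝ (ZMod (Nm m) → ℝ) where
  carrier := {u | IsKFun m u ∧ (∀ n, u (-n) = e1 * u n) ∧
    (∀ n, u (((5 ^ m : ℕ) : ZMod (Nm m)) - n) = e2 * u n)}
  add_mem' := by
    rintro u v ⟨hu, hu1, hu2⟩ ⟨hv, hv1, hv2⟩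
    refine ⟨fun n => by simp only [Pi.add_apply, hu n, hv n],
      fun n => by simp only [Pi.add_apply, hu1 n, hv1 n]; ring,
      fun n => by simp only [Pi.add_apply, hu2 n, hv2 n]; ring⟩
  zero_mem' := ⟨fun _ => rfl, fun n => by simp, fun n => by simp⟩
  smul_mem' := by
    rintro c u ⟨hu, hu1, hu2⟩
    refine ⟨fun n => by simp only [Pi.smul_apply, hu n],
      fun n => by simp only [Pi.smul_apply, smul_eq_mul, hu1 n]; ring,
      fun n => by simp only [Pi.smul_apply, smul_eq_mul, hu2 n]; ring⟩

instance neZero_Nm (m : ℕ) : NeZero (Nm m) := ⟨by unfold Nm; positivity⟩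

theorem Nm_succ (m : ℕ) : Nm (m + 1) = 5 * Nm m := by unfold Nm; ring

theorem zmultiplesHom_five_Nm (m : ℕ) :
    zmultiplesHom (ZMod (Nm (m + 1))) 5 (Nm m : ℤ) = 0 := by
  have h : ((5 * Nm m : ℕ) : ZMod (Nm (m + 1))) = 0 := by
    rw [← Nm_succ, ZMod.natCast_self]
  simp only [zmultiplesHom_apply, natCast_zsmul, nsmul_eq_mul]
  rw [mul_comm]
  exact_mod_cast h

/-- The inclusion `n ↦ 5n` of the vertices of level `m` into those of level `m + 1`. -/
def emb (m : ℕ) : ZMod (Nm m) →+ ZMod (Nm (m + 1)) :=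
  ZMod.lift (Nm m) ⟨zmultiplesHom _ 5, zmultiplesHom_five_Nm m⟩

theorem emb_natCast (m k : ℕ) : emb m (k : ZMod (Nm m)) = ((5 * k : ℕ) : ZMod (Nm (m + 1))) := by
  have h := ZMod.lift_coe (Nm m) (A := ZMod (Nm (m + 1)))
    ⟨zmultiplesHom _ 5, zmultiplesHom_five_Nm m⟩ (k : ℤ)
  simp only [Int.cast_natCast, zmultiplesHom_apply, natCast_zsmul, nsmul_eq_mul] at h
  rw [emb, h]
  push_cast
  ring

theorem emb_one (m : ℕ) : emb m 1 = 5 := by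
  simpa using emb_natCast m 1

theorem val_emb_add (m : ℕ) (n : ZMod (Nm m)) (r : ℕ) (hr : r < 5) :
    (emb m n + (r : ZMod (Nm (m + 1)))).val = 5 * n.val + r := by
  have hn := n.val_lt
  conv_lhs => rw [← ZMod.natCast_zmod_val n]
  rw [emb_natCast, ← Nat.cast_add]
  apply ZMod.val_cast_of_lt
  rw [Nm_succ]
  omega

theorem val_emb (m : ℕ) (n : ZMod (Nm m)) : (emb m n).val = 5 * n.val := by
  simpa using val_emb_add m n 0 (by norm_num)

theorem exists_eq_emb_add (m : ℕ) (x : ZMod (Nm (m + 1))) :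
    ∃ (n : ZMod (Nm m)) (r : ℕ), r < 5 ∧ x = emb m n + (r : ZMod (Nm (m + 1))) := by
  refine ⟨((x.val / 5 : ℕ) : ZMod (Nm m)), x.val % 5, Nat.mod_lt _ (by norm_num), ?_⟩
  rw [emb_natCast, ← Nat.cast_add, Nat.div_add_mod, ZMod.natCast_zmod_val]

theorem partner_emb (m : ℕ) (n : ZMod (Nm m)) :
    partner (m + 1) (emb m n) = emb m (partner m n) := by
  have hw : (if n.val = 0 then Nm m else n.val) ≠ 0 := by
    split_ifs with h
    · exact NeZero.ne _
    · exact h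
  have hv : (if (emb m n).val = 0 then Nm (m + 1) else (emb m n).val)
      = 5 * (if n.val = 0 then Nm m else n.val) := by
    rw [val_emb, Nm_succ]
    split_ifs <;> omega
  simp only [partner, hv]
  generalize (if n.val = 0 then Nm m else n.val) = w at hw
  have : Fact (Nat.Prime 5) := ⟨by norm_num⟩
  rw [padicValNat.mul (by norm_num) hw, padicValNat.self (by norm_num), pow_add, pow_one,
    Nat.mul_div_mul_left _ _ (by norm_num)]
  split_ifs
  · rw [map_add, emb_natCast]
  · rw [map_sub, emb_natCast]

theorem partner_emb_add (m : ℕ) (n : ZMod (Nm m)) (r : ℕ) (hr0 : r ≠ 0) (hr : r < 5) :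
    partner (m + 1) (emb m n + (r : ZMod (Nm (m + 1)))) =
      if r = 1 ∨ r = 3 then emb m n + (r : ZMod (Nm (m + 1))) + 1
      else emb m n + (r : ZMod (Nm (m + 1))) - 1 := by
  have hp : padicValNat 5 (5 * n.val + r) = 0 :=
    padicValNat.eq_zero_of_not_dvd (by omega)
  have hmod : (5 * n.val + r) % 5 = r := by omega
  have hne : 5 * n.val + r ≠ 0 := by omega
  simp only [partner, val_emb_add m n r hr, if_neg hne, hp, pow_zero, Nat.div_one, hmod,
    Nat.cast_one]

theorem extFun_emb_add (m : ℕ) (l : ℝ) (u : ZMod (Nm m) → ℝ) (n : ZMod (Nm m)) (r : ℕ)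
    (hr : r < 5) :
    extFun m l u (emb m n + (r : ZMod (Nm (m + 1)))) =
      if r = 0 then u n
      else if r = 1 ∨ r = 2 then ((2 - l) * u n + u (n + 1)) / ((1 - l) * (3 - l))
      else (u n + (2 - l) * u (n + 1)) / ((1 - l) * (3 - l)) := by
  have hmod : (5 * n.val + r) % 5 = r := by omega
  have hdiv : (5 * n.val + r) / 5 = n.val := by omega
  simp only [extFun, val_emb_add m n r hr, hmod, hdiv, ZMod.natCast_zmod_val]

/-- If `u` is a `λ`-eigenfunction of `−Δ_m` and `R(λ') = λ` with
`λ' ∉ {1,3}`, then the `λ'`-extension of `u` is a `λ'`-eigenfunction of `−Δ_{m+1}`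
(in particular, a well-defined nonzero function on `K_{m+1}`). -/
theorem extension_is_eigenfunction (m : ℕ) (hm : 1 ≤ m) (lam lam' : ℝ)
    (u : ZMod (Nm m) → ℝ) (hu : IsEigen m lam u)
    (h1 : lam' ≠ 1) (h3 : lam' ≠ 3) (hR : R lam' = lam) :
    IsEigen (m + 1) lam' (extFun m lam' u) := by
  obtain ⟨hK, hne, hlap⟩ := hu
  have e0 : ∀ n, extFun m lam' u (emb m n) = u n := fun n => by
    simpa using extFun_emb_add m lam' u n 0 (by norm_num)
  have e1 : ∀ n, extFun m lam' u (emb m n + 1) =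
      ((2 - lam') * u n + u (n + 1)) / ((1 - lam') * (3 - lam')) := fun n => by
    simpa using extFun_emb_add m lam' u n 1 (by norm_num)
  have e2 : ∀ n, extFun m lam' u (emb m n + 2) =
      ((2 - lam') * u n + u (n + 1)) / ((1 - lam') * (3 - lam')) := fun n => by
    simpa using extFun_emb_add m lam' u n 2 (by norm_num)
  have e3 : ∀ n, extFun m lam' u (emb m n + 3) =
      (u n + (2 - lam') * u (n + 1)) / ((1 - lam') * (3 - lam')) := fun n => by
    simpa using extFun_emb_add m lam' u n 3 (by norm_num)
  have e4 : ∀ n, extFun m lam' u (emb m n + 4) =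
      (u n + (2 - lam') * u (n + 1)) / ((1 - lam') * (3 - lam')) := fun n => by
    simpa using extFun_emb_add m lam' u n 4 (by norm_num)
  have p1 : ∀ n, partner (m + 1) (emb m n + 1) = emb m n + 2 := fun n => by
    have h := partner_emb_add m n 1 (by norm_num) (by norm_num)
    norm_num at h
    rw [h]; ring
  have p2 : ∀ n, partner (m + 1) (emb m n + 2) = emb m n + 1 := fun n => by
    have h := partner_emb_add m n 2 (by norm_num) (by norm_num)
    norm_num at h
    rw [h]; ring
  have p3 : ∀ n, partner (m + 1) (emb m n + 3) = emb m n + 4 := fun n => by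
    have h := partner_emb_add m n 3 (by norm_num) (by norm_num)
    norm_num at h
    rw [h]; ring
  have p4 : ∀ n, partner (m + 1) (emb m n + 4) = emb m n + 3 := fun n => by
    have h := partner_emb_add m n 4 (by norm_num) (by norm_num)
    norm_num at h
    rw [h]; ring
  have em : ∀ n, extFun m lam' u (emb m n - 1) =
      (u (n - 1) + (2 - lam') * u n) / ((1 - lam') * (3 - lam')) := fun n => by
    have h : emb m n - 1 = emb m (n - 1) + 4 := by rw [map_sub, emb_one]; ring
    rw [h, e4, sub_add_cancel]
  have e5 : ∀ n, extFun m lam' u (emb m n + 5) = u (n + 1) := fun n => by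
    rw [← emb_one, ← map_add, e0]
  have d1 : 1 - lam' ≠ 0 := sub_ne_zero.mpr h1.symm
  have d3 : 3 - lam' ≠ 0 := sub_ne_zero.mpr h3.symm
  refine ⟨fun x => ?_, fun h0 => hne ?_, fun x => ?_⟩
  · obtain ⟨n, r, hr, rfl⟩ := exists_eq_emb_add m x
    interval_cases r
    · simp only [Nat.cast_zero, add_zero]
      rw [partner_emb, e0, e0, hK]
    · simp only [Nat.cast_one]
      rw [p1, e1, e2]
    · simp only [Nat.cast_ofNat]
      rw [p2, e1, e2]
    · simp only [Nat.cast_ofNat]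
      rw [p3, e3, e4]
    · simp only [Nat.cast_ofNat]
      rw [p4, e3, e4]
  · funext n
    rw [← e0 n, h0]
    rfl
  · obtain ⟨n, r, hr, rfl⟩ := exists_eq_emb_add m x
    have s10 : emb m n + 1 - 1 = emb m n := by ring
    have s11 : emb m n + 1 + 1 = emb m n + 2 := by ring
    have s20 : emb m n + 2 - 1 = emb m n + 1 := by ring
    have s21 : emb m n + 2 + 1 = emb m n + 3 := by ring
    have s30 : emb m n + 3 - 1 = emb m n + 2 := by ring
    have s31 : emb m n + 3 + 1 = emb m n + 4 := by ring
    have s40 : emb m n + 4 - 1 = emb m n + 3 := by ring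
    have s41 : emb m n + 4 + 1 = emb m n + 5 := by ring
    interval_cases r
    · simp only [Nat.cast_zero, add_zero, lap, partner_emb]
      have h := hlap n
      simp only [lap, ← hR, R] at h
      rw [e0, e1, em, e1, em, hK]
      field_simp
      linear_combination h
    all_goals simp only [Nat.cast_one, Nat.cast_ofNat, lap, p1, p2, p3, p4, s10, s11, s20, s21,
      s30, s31, s40, s41, e0, e1, e2, e3, e4, e5]
    all_goals
      field_simp
      ring

end VNLE
end
end

section
/- Fix m ≥ 1 and signs ε₁, ε₂ ∈ {+1, −1}. The space V_{ε₁,ε₂} = {u a function on K_m : u(−n) = ε₁ u(n) and u(5^m − n) = ε₂ u(n) for all n ∈ ℤ/N_mℤ} is invariant under −Δ_m, and its dimension equals (5^m − 1)/4 + 1 if ε₁ = ε₂ = +1, and equals (5^m − 1)/4 for each of the other three sign choices; consequently, sorting the eigenspaces of −Δ_m into these four symmetry types, the (+,−), (−,+) and (−,−) types have total dimension (5^m − 1)/4 each, while the (+,+) type has total dimension one higher. -/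
open scoped BigOperators

noncomputable section

namespace VNLE

section General

/-- A linear operator that is symmetric for a positive definite symmetric bilinear form on a
finite-dimensional real space is diagonalizable. -/
theorem iSup_eigenspace_eq_top_of_posDef {V : Type*} [AddCommGroup V] [Module ℝ V]
    [FiniteDimensional ℝ V] (B : V →ₗ[ℝ] V →ₗ[ℝ] ℝ) (hsymm : ∀ x y, B x y = B y x)
    (hpos : ∀ x, x ≠ 0 → 0 < B x x) (f : Module.End ℝ V)
    (hf : ∀ x y, B (f x) y = B x (f y)) :
    ⨆ μ : ℝ, Module.End.eigenspace f μ = ⊤ := by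
  let core : InnerProductSpace.Core ℝ V :=
    { inner := fun x y => B x y
      conj_inner_symm := fun x y => by simp [hsymm y x]
      re_inner_nonneg := fun x => by
        rcases eq_or_ne x 0 with rfl | hx
        · simp
        · simpa using (hpos x hx).le
      add_left := fun x y z => by simp
      smul_left := fun x y r => by simp
      definite := fun x hx => by
        by_contra h
        exact (hpos x h).ne' hx }
  let _ : NormedAddCommGroup V := core.toNormedAddCommGroup
  let _ : InnerProductSpace ℝ V := InnerProductSpace.ofCore core.toCore
  have hs : LinearMap.IsSymmetric f := fun x y => hf x y
  exact (Submodule.orthogonal_eq_bot_iff).1 hs.orthogonalComplement_iSup_eigenspaces_eq_bot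

theorem trace_pi_eq_sum {X : Type*} [Fintype X] [DecidableEq X]
    (f : (X → ℝ) →ₗ[ℝ] (X → ℝ)) :
    LinearMap.trace ℝ (X → ℝ) f = ∑ x, f (Pi.single x 1) x := by
  rw [LinearMap.trace_eq_matrix_trace ℝ (Pi.basisFun ℝ X), Matrix.trace]
  simp

/-- The average of the eight composites of three commuting substitutions, weighted by signs. -/
def signedAverage {X : Type*} (p s t : X → X) (e1 e2 : ℝ) : (X → ℝ) →ₗ[ℝ] (X → ℝ) where
  toFun u x := (u x + u (p x) + e1 * (u (s x) + u (p (s x))) + e2 * (u (t x) + u (p (t x)))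
    + e1 * e2 * (u (s (t x)) + u (p (s (t x))))) / 8
  map_add' u v := by funext x; simp only [Pi.add_apply]; ring
  map_smul' c u := by
    funext x; simp only [Pi.smul_apply, smul_eq_mul, RingHom.id_apply]; ring

theorem signedAverage_apply {X : Type*} (p s t : X → X) (e1 e2 : ℝ) (u : X → ℝ) (x : X) :
    signedAverage p s t e1 e2 u x =
      (u x + u (p x) + e1 * (u (s x) + u (p (s x))) + e2 * (u (t x) + u (p (t x)))
        + e1 * e2 * (u (s (t x)) + u (p (s (t x))))) / 8 := rfl

theorem finrank_eq_trace_signedAverage {X : Type*} [Fintype X] (p s t : X → X) (e1 e2 : ℝ)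
    (hp : ∀ x, p (p x) = x) (hs : ∀ x, s (s x) = x) (ht : ∀ x, t (t x) = x)
    (hps : ∀ x, s (p x) = p (s x)) (hpt : ∀ x, t (p x) = p (t x))
    (hst : ∀ x, t (s x) = s (t x)) (h1 : e1 * e1 = 1) (h2 : e2 * e2 = 1)
    (V : Submodule ℝ (X → ℝ))
    (hV : ∀ u, u ∈ V ↔
      (∀ x, u (p x) = u x) ∧ (∀ x, u (s x) = e1 * u x) ∧ ∀ x, u (t x) = e2 * u x) :
    (Module.finrank ℝ V : ℝ) = LinearMap.trace ℝ (X → ℝ) (signedAverage p s t e1 e2) := by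
  refine (LinearMap.IsProj.trace (p := V) ⟨fun u => ?_, fun u hu => ?_⟩).symm
  · rw [hV]
    refine ⟨fun x => ?_, fun x => ?_, fun x => ?_⟩
    · simp only [signedAverage_apply, hps, hpt, hp]
      ring
    · simp only [signedAverage_apply, hst, hs]
      linear_combination (-(u (s x) + u (p (s x))) / 8
        - e2 * (u (s (t x)) + u (p (s (t x)))) / 8) * h1
    · simp only [signedAverage_apply, ht, ← hst]
      linear_combination (-(u (t x) + u (p (t x))) / 8
        - e1 * (u (t (s x)) + u (p (t (s x)))) / 8) * h2
  · obtain ⟨hup, hus, hut⟩ := (hV u).1 hu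
    funext x
    simp only [signedAverage_apply, hup, hus, hut]
    linear_combination (u x / 4) * h1 + (u x / 4) * h2 + (u x / 4) * (e2 * e2 * h1 + h2)

end General

section Partner

theorem two_dvd_Nm (m : ℕ) : 2 ∣ Nm m := Dvd.intro _ rfl

/-- The antipode `5^m` of `0` in `ℤ/N_mℤ`. -/
def antipode (m : ℕ) : ZMod (Nm m) := ((5 ^ m : ℕ) : ZMod (Nm m))

theorem antipode_eq_intCast (m : ℕ) : antipode m = ((5 ^ m : ℤ) : ZMod (Nm m)) := by
  simp [antipode]

theorem intCast_eq_zero_iff (m : ℕ) (a : ℤ) :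
    (a : ZMod (Nm m)) = 0 ↔ 2 * 5 ^ m ∣ a := by
  rw [ZMod.intCast_zmod_eq_zero_iff_dvd]
  simp [Nm]

theorem intCast_pow_mul_eq_zero {m k : ℕ} (hk : k < m) {a : ℤ}
    (h : ((5 ^ k * a : ℤ) : ZMod (Nm m)) = 0) : 10 ∣ a := by
  rw [intCast_eq_zero_iff] at h
  obtain ⟨d, rfl⟩ := Nat.exists_eq_add_of_lt hk
  have h' : (5 : ℤ) ^ k * (10 * 5 ^ d) ∣ 5 ^ k * a := by
    convert h using 1; ring
  exact (Dvd.intro _ rfl).trans (Int.dvd_of_mul_dvd_mul_left (by positivity) h')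

theorem antipode_add_self (m : ℕ) : antipode m + antipode m = 0 := by
  rw [antipode_eq_intCast, ← Int.cast_add, intCast_eq_zero_iff]
  exact ⟨1, by ring⟩

theorem neg_antipode (m : ℕ) : -antipode m = antipode m :=
  neg_eq_of_add_eq_zero_left (antipode_add_self m)

theorem antipode_val (m : ℕ) : (antipode m).val = 5 ^ m := by
  rw [antipode, ZMod.val_natCast, Nat.mod_eq_of_lt]
  have : 0 < 5 ^ m := by positivity
  unfold Nm; omega

theorem antipode_ne_zero (m : ℕ) : antipode m ≠ 0 := by
  intro h
  have h' := antipode_val m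
  rw [h, ZMod.val_zero] at h'
  exact absurd h' (by positivity)

theorem partner_zero (m : ℕ) : partner m 0 = antipode m := by
  have hv : padicValNat 5 (Nm m) = m := by
    have : Fact (Nat.Prime 5) := ⟨by norm_num⟩
    rw [Nm, padicValNat.mul (by norm_num) (by positivity), padicValNat.prime_pow,
      padicValNat.eq_zero_of_not_dvd (by norm_num), zero_add]
  have hd : Nm m / 5 ^ m = 2 := Nat.mul_div_cancel _ (by positivity)
  simp only [partner, ZMod.val_zero, if_true, hv, hd]
  rw [if_neg (by norm_num), zero_sub]
  exact neg_antipode m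

theorem partner_antipode (m : ℕ) : partner m (antipode m) = 0 := by
  have : Fact (Nat.Prime 5) := ⟨by norm_num⟩
  have h0 : (5 ^ m : ℕ) ≠ 0 := by positivity
  simp only [partner, antipode_val, if_neg h0, padicValNat.prime_pow,
    Nat.div_self (Nat.pos_of_ne_zero h0)]
  exact antipode_add_self m

/-- The displacement `±1` of the unit part of a vertex under the partner map. -/
def shift (a : ℤ) : ℤ := if a % 5 = 1 ∨ a % 5 = 3 then 1 else -1

theorem partner_pow_mul {m k : ℕ} (hk : k < m) (a : ℤ) (ha : ¬ 5 ∣ a) :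
    partner m ((5 ^ k * a : ℤ) : ZMod (Nm m)) =
      ((5 ^ k * (a + shift a) : ℤ) : ZMod (Nm m)) := by
  have : Fact (Nat.Prime 5) := ⟨by norm_num⟩
  have hk0 : (5 ^ k : ℕ) ≠ 0 := by positivity
  obtain ⟨b, hb5, hb⟩ : ∃ b : ℕ, (b : ℤ) % 5 = a % 5 ∧
      ((5 ^ k * a : ℤ) : ZMod (Nm m)).val = 5 ^ k * b := by
    obtain ⟨d, rfl⟩ := Nat.exists_eq_add_of_lt hk
    have hN : ((Nm (k + d + 1) : ℕ) : ℤ) = 5 ^ k * (10 * 5 ^ d) := by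
      simp only [Nm]; push_cast; ring
    have hpos : (0 : ℤ) < 10 * 5 ^ d := by positivity
    refine ⟨(a % (10 * 5 ^ d)).toNat, ?_, ?_⟩
    · rw [Int.toNat_of_nonneg (Int.emod_nonneg _ hpos.ne')]
      exact Int.emod_emod_of_dvd _ ⟨2 * 5 ^ d, by ring⟩
    · rw [← Int.natCast_inj, Nat.cast_mul, Nat.cast_pow, Int.toNat_of_nonneg
        (Int.emod_nonneg _ hpos.ne'), ZMod.val_intCast, hN, Int.mul_emod_mul_of_pos _ _ (by positivity)]
      norm_num
  have hb' : ¬ 5 ∣ b := by omega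
  have hb0 : b ≠ 0 := by rintro rfl; simp at hb'
  have hval : padicValNat 5 (5 ^ k * b) = k := by
    rw [padicValNat.mul hk0 hb0, padicValNat.prime_pow,
      padicValNat.eq_zero_of_not_dvd hb', add_zero]
  simp only [partner, hb, if_neg (mul_ne_zero hk0 hb0), hval,
    Nat.mul_div_cancel_left b (Nat.pos_of_ne_zero hk0)]
  by_cases hc : b % 5 = 1 ∨ b % 5 = 3
  · rw [if_pos hc, shift, if_pos (by omega)]
    push_cast; ring
  · rw [if_neg hc, shift, if_neg (by omega)]
    push_cast; ring

theorem vertex_cases {m : ℕ} {P : ZMod (Nm m) → Prop} (h0 : P 0) (h1 : P (antipode m))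
    (h2 : ∀ (k : ℕ) (a : ℤ), k < m → ¬ 5 ∣ a → P ((5 ^ k * a : ℤ) : ZMod (Nm m)))
    (n : ZMod (Nm m)) : P n := by
  obtain ⟨z, rfl⟩ := ZMod.intCast_surjective n
  by_cases hz : (5 : ℤ) ^ m ∣ z
  · obtain ⟨c, rfl⟩ := hz
    rcases Int.even_or_odd' c with ⟨d, rfl | rfl⟩
    · have : ((5 ^ m * (2 * d) : ℤ) : ZMod (Nm m)) = 0 := by
        rw [intCast_eq_zero_iff]; exact ⟨d, by ring⟩
      rwa [this]
    · have : ((5 ^ m * (2 * d + 1) : ℤ) : ZMod (Nm m)) = antipode m := by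
        rw [antipode_eq_intCast, ← sub_eq_zero, ← Int.cast_sub, intCast_eq_zero_iff]
        exact ⟨d, by ring⟩
      rwa [this]
  · have hz0 : z ≠ 0 := by rintro rfl; simp at hz
    have hfin : FiniteMultiplicity 5 z := Int.finiteMultiplicity_iff.2 ⟨by norm_num, hz0⟩
    obtain ⟨k, a, rfl, ha⟩ : ∃ k a, z = 5 ^ k * a ∧ ¬ 5 ∣ a :=
      ⟨_, hfin.exists_eq_pow_mul_and_not_dvd⟩
    refine h2 k a ?_ ha
    by_contra! hk
    exact hz ((pow_dvd_pow 5 hk).trans (Dvd.intro _ rfl))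

theorem shift_add_shift {a : ℤ} (ha : ¬ 5 ∣ a) : shift (a + shift a) = -shift a := by
  unfold shift; split_ifs <;> omega

theorem not_dvd_add_shift (a : ℤ) : ¬ 5 ∣ a + shift a := by
  unfold shift; split_ifs <;> omega

theorem shift_mul_five_sub {a : ℤ} (c : ℤ) (ha : ¬ 5 ∣ a) : shift (5 * c - a) = -shift a := by
  unfold shift; split_ifs <;> omega

theorem partner_partner {m : ℕ} (n : ZMod (Nm m)) : partner m (partner m n) = n := by
  induction n using vertex_cases with
  | h0 => rw [partner_zero, partner_antipode]
  | h1 => rw [partner_antipode, partner_zero]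
  | h2 k a hk ha =>
    rw [partner_pow_mul hk a ha, partner_pow_mul hk _ (not_dvd_add_shift a),
      shift_add_shift ha, add_neg_cancel_right]

theorem partner_neg {m : ℕ} (n : ZMod (Nm m)) : partner m (-n) = -partner m n := by
  induction n using vertex_cases with
  | h0 => rw [neg_zero, partner_zero, neg_antipode]
  | h1 => rw [neg_antipode, partner_antipode, neg_zero]
  | h2 k a hk ha =>
    have h := shift_mul_five_sub 0 ha
    rw [mul_zero, zero_sub] at h
    rw [partner_pow_mul hk a ha, ← Int.cast_neg, ← mul_neg,
      partner_pow_mul hk (-a) (by omega), h, ← Int.cast_neg]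
    congr 1; ring

theorem partner_antipode_sub {m : ℕ} (n : ZMod (Nm m)) :
    partner m (antipode m - n) = antipode m - partner m n := by
  induction n using vertex_cases with
  | h0 => rw [sub_zero, partner_zero, partner_antipode, sub_self]
  | h1 => rw [sub_self, partner_antipode, partner_zero, sub_zero]
  | h2 k a hk ha =>
    obtain ⟨d, rfl⟩ := Nat.exists_eq_add_of_lt hk
    have e : ∀ b : ℤ, antipode (k + d + 1) - ((5 ^ k * b : ℤ) : ZMod (Nm (k + d + 1))) =
        ((5 ^ k * (5 * 5 ^ d - b) : ℤ) : ZMod (Nm (k + d + 1))) := fun b => by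
      rw [antipode_eq_intCast, ← Int.cast_sub]
      congr 1; ring
    rw [partner_pow_mul hk a ha, e, e, partner_pow_mul hk _ (by omega),
      shift_mul_five_sub _ ha]
    congr 2; ring

theorem castHom_antipode (m : ℕ) :
    ZMod.castHom (two_dvd_Nm m) (ZMod 2) (antipode m) = 1 := by
  rw [antipode, map_natCast, Nat.cast_pow]
  have : ((5 : ℕ) : ZMod 2) = 1 := by decide
  rw [this, one_pow]

theorem castHom_partner {m : ℕ} (n : ZMod (Nm m)) :
    ZMod.castHom (two_dvd_Nm m) (ZMod 2) (partner m n) =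
      ZMod.castHom (two_dvd_Nm m) (ZMod 2) n + 1 := by
  have h5 : (5 : ZMod 2) = 1 := by decide
  induction n using vertex_cases with
  | h0 => rw [partner_zero, castHom_antipode, map_zero, zero_add]
  | h1 => rw [partner_antipode, castHom_antipode, map_zero]; decide
  | h2 k a hk ha =>
    have hs : (shift a : ZMod 2) = 1 := by
      unfold shift; split_ifs <;> decide
    rw [partner_pow_mul hk a ha, map_intCast, map_intCast]
    push_cast
    rw [h5, hs, one_pow, one_mul, one_mul]

theorem add_one_ne_self_zmod_two : ∀ x : ZMod 2, x + 1 ≠ x := by decide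

theorem one_sub_ne_self_zmod_two : ∀ x : ZMod 2, 1 - x ≠ x := by decide

theorem partner_ne_self {m : ℕ} (n : ZMod (Nm m)) : partner m n ≠ n := fun h =>
  add_one_ne_self_zmod_two _ (by rw [← castHom_partner, h])

theorem antipode_sub_ne_self {m : ℕ} (n : ZMod (Nm m)) : antipode m - n ≠ n := fun h => by
  have := congrArg (ZMod.castHom (two_dvd_Nm m) (ZMod 2)) h
  rw [map_sub, castHom_antipode] at this
  exact one_sub_ne_self_zmod_two _ this

theorem neg_antipode_sub_ne_self {m : ℕ} (n : ZMod (Nm m)) : -(antipode m - n) ≠ n :=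
  fun h => antipode_ne_zero m (by
    rw [← neg_eq_zero]
    linear_combination h)

theorem partner_neg_ne_self {m : ℕ} (n : ZMod (Nm m)) : partner m (-n) ≠ n := fun h => by
  have := castHom_partner (-n)
  rw [h, map_neg] at this
  revert this
  generalize ZMod.castHom (two_dvd_Nm m) (ZMod 2) n = x
  revert x
  decide

theorem neg_eq_self_iff_zero_or_antipode {m : ℕ} (n : ZMod (Nm m)) : -n = n ↔ n = 0 ∨ n = antipode m := by
  refine ⟨fun h => ?_, ?_⟩
  · induction n using vertex_cases with
    | h0 => exact Or.inl rfl
    | h1 => exact Or.inr rfl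
    | h2 k a hk ha =>
      have h' : ((5 ^ k * (2 * a) : ℤ) : ZMod (Nm m)) = 0 := by
        push_cast at h ⊢
        linear_combination -h
      have := intCast_pow_mul_eq_zero hk h'
      omega
  · rintro (rfl | rfl)
    · exact neg_zero
    · exact neg_antipode m

theorem partner_antipode_sub_eq_self_iff {m : ℕ} (n : ZMod (Nm m)) :
    partner m (antipode m - n) = n ↔ n = 0 ∨ n = antipode m := by
  refine ⟨fun h => ?_, ?_⟩
  · induction n using vertex_cases with
    | h0 => exact Or.inl rfl
    | h1 => exact Or.inr rfl
    | h2 k a hk ha =>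
      obtain ⟨d, rfl⟩ := Nat.exists_eq_add_of_lt hk
      rw [partner_antipode_sub, partner_pow_mul hk a ha, antipode_eq_intCast] at h
      have h' : ((5 ^ k * (2 * a + shift a - 5 * 5 ^ d) : ℤ) : ZMod (Nm (k + d + 1))) = 0 := by
        push_cast at h ⊢
        linear_combination -h
      have := intCast_pow_mul_eq_zero hk h'
      unfold shift at this
      split_ifs at this <;> omega
  · rintro (rfl | rfl)
    · rw [sub_zero, partner_antipode]
    · rw [sub_self, partner_zero]

theorem partner_neg_antipode_sub_eq_self_iff {m : ℕ} (n : ZMod (Nm m)) :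
    partner m (-(antipode m - n)) = n ↔ n = 0 ∨ n = antipode m := by
  refine ⟨fun h => ?_, ?_⟩
  · induction n using vertex_cases with
    | h0 => exact Or.inl rfl
    | h1 => exact Or.inr rfl
    | h2 k a hk ha =>
      obtain ⟨d, rfl⟩ := Nat.exists_eq_add_of_lt hk
      rw [partner_neg, partner_antipode_sub, partner_pow_mul hk a ha, antipode_eq_intCast] at h
      have h' : ((5 ^ k * (shift a - 5 * 5 ^ d) : ℤ) : ZMod (Nm (k + d + 1))) = 0 := by
        push_cast at h ⊢
        linear_combination h
      have := intCast_pow_mul_eq_zero hk h'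
      unfold shift at this
      split_ifs at this <;> omega
  · rintro (rfl | rfl)
    · rw [sub_zero, neg_antipode, partner_antipode]
    · rw [sub_self, neg_zero, partner_zero]

end Partner

section Laplacian

variable {m : ℕ} {e1 e2 : ℝ}

theorem lap_mem_symSub {u : ZMod (Nm m) → ℝ} (hu : u ∈ symSub m e1 e2) :
    lap m u ∈ symSub m e1 e2 := by
  obtain ⟨hu, h1, h2⟩ := hu
  refine ⟨fun n => ?_, fun n => ?_, fun n => ?_⟩
  · simp only [lap, partner_partner, hu n]
    ring
  · simp only [lap, partner_neg, h1 n]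
    rw [show -n + 1 = -(n - 1) by ring, show -n - 1 = -(n + 1) by ring,
      show -partner m n + 1 = -(partner m n - 1) by ring,
      show -partner m n - 1 = -(partner m n + 1) by ring, h1, h1, h1, h1]
    ring
  · have h2 : ∀ n, u (antipode m - n) = e2 * u n := h2
    change lap m u (antipode m - n) = _
    simp only [lap, partner_antipode_sub, h2 n]
    rw [show antipode m - n + 1 = antipode m - (n - 1) by ring,
      show antipode m - n - 1 = antipode m - (n + 1) by ring,
      show antipode m - partner m n + 1 = antipode m - (partner m n - 1) by ring,
      show antipode m - partner m n - 1 = antipode m - (partner m n + 1) by ring,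
      h2, h2, h2, h2]
    ring

theorem sum_lap_mul {u v : ZMod (Nm m) → ℝ} (hv : IsKFun m v) :
    ∑ n, lap m u n * v n =
      4 * ∑ n, u n * v n - 2 * ∑ n, u (n + 1) * v n - 2 * ∑ n, u n * v (n + 1) := by
  have hp : ∀ f : ZMod (Nm m) → ℝ, ∑ n, f (partner m n) * v n = ∑ n, f n * v n := fun f => by
    have hinv : Function.Involutive (partner m) := partner_partner
    rw [← Equiv.sum_comp hinv.toPerm (fun n => f n * v n)]
    exact Finset.sum_congr rfl fun n _ => by
      simp only [Function.Involutive.coe_toPerm, hv n]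
  have hm : ∑ n, u (n - 1) * v n = ∑ n, u n * v (n + 1) := by
    rw [← Equiv.sum_comp (Equiv.addRight (1 : ZMod (Nm m))) (fun n => u (n - 1) * v n)]
    simp
  have h1 := hp fun n => u (n + 1)
  have h2 := hp fun n => u (n - 1)
  simp only [lap, sub_mul, Finset.sum_sub_distrib, h1, h2, hm, mul_assoc, ← Finset.mul_sum]
  ring

theorem sum_lap_mul_comm {u v : ZMod (Nm m) → ℝ} (hu : IsKFun m u) (hv : IsKFun m v) :
    ∑ n, lap m u n * v n = ∑ n, u n * lap m v n := by
  simp only [mul_comm (u _) (lap m v _)]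
  rw [sum_lap_mul hv, sum_lap_mul hu]
  simp only [mul_comm]
  ring

theorem iSup_eigensp_inf_symSub : ⨆ lam : ℝ, eigensp m lam ⊓ symSub m e1 e2 = symSub m e1 e2 := by
  refine le_antisymm (iSup_le fun _ => inf_le_right) ?_
  let f : Module.End ℝ (symSub m e1 e2) :=
    (lapL m).restrict fun u hu => lap_mem_symSub hu
  let B : symSub m e1 e2 →ₗ[ℝ] symSub m e1 e2 →ₗ[ℝ] ℝ :=
    (dotProductBilin ℝ ℝ).domRestrict₁₂ (symSub m e1 e2) (symSub m e1 e2)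
  have htop : ⨆ μ : ℝ, Module.End.eigenspace f μ = ⊤ := by
    refine iSup_eigenspace_eq_top_of_posDef B (fun u v => dotProduct_comm _ _)
      (fun u hu => ?_) f (fun u v => sum_lap_mul_comm u.2.1 v.2.1)
    refine lt_of_le_of_ne (Finset.sum_nonneg fun n _ => mul_self_nonneg _) fun h => hu ?_
    exact Subtype.ext (dotProduct_self_eq_zero.1 h.symm)
  calc symSub m e1 e2 = (⊤ : Submodule ℝ (symSub m e1 e2)).map (symSub m e1 e2).subtype := by simp
    _ = ⨆ μ : ℝ, (Module.End.eigenspace f μ).map (symSub m e1 e2).subtype := by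
      rw [← htop, Submodule.map_iSup]
    _ ≤ _ := iSup_mono fun μ => by
      rintro _ ⟨u, hu, rfl⟩
      refine ⟨⟨?_, u.2.1⟩, u.2⟩
      have h := congrArg Subtype.val (Module.End.mem_eigenspace_iff.1 hu)
      exact LinearMap.mem_ker.2 (sub_eq_zero.2 h)

theorem finrank_symSub (h1 : e1 * e1 = 1) (h2 : e2 * e2 = 1) :
    4 * (Module.finrank ℝ (symSub m e1 e2) : ℝ) = 5 ^ m + e1 + e2 + e1 * e2 := by
  have hfix : ∑ n : ZMod (Nm m), (if n = 0 ∨ n = antipode m then (1 : ℝ) else 0) = 2 := by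
    rw [Finset.sum_boole]
    have : (Finset.univ.filter fun n : ZMod (Nm m) => n = 0 ∨ n = antipode m) =
        {0, antipode m} := by ext; simp
    rw [this, Finset.card_pair (antipode_ne_zero m).symm]
    norm_num
  rw [finrank_eq_trace_signedAverage (partner m) (fun n => -n) (fun n => antipode m - n) e1 e2
    partner_partner neg_neg (sub_sub_cancel _) (fun n => (partner_neg n).symm)
    (fun n => (partner_antipode_sub n).symm)
    (fun n => by linear_combination antipode_add_self m) h1 h2 (symSub m e1 e2)
    (fun u => Iff.rfl), trace_pi_eq_sum]
  simp only [signedAverage_apply, Pi.single_apply, if_true, partner_ne_self, if_false,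
    antipode_sub_ne_self, neg_antipode_sub_ne_self, partner_neg_ne_self, neg_eq_self_iff_zero_or_antipode,
    partner_antipode_sub_eq_self_iff, partner_neg_antipode_sub_eq_self_iff, add_zero, zero_add]
  rw [← Finset.sum_div]
  simp only [Finset.sum_add_distrib, ← Finset.mul_sum, hfix]
  rw [Finset.sum_const, Finset.card_univ, ZMod.card, nsmul_eq_mul, Nm]
  push_cast
  ring

end Laplacian

/-- The symmetry-type subspaces `V_{ε₁,ε₂}` are invariant under `−Δ_m`;
their dimensions are `(5^m − 1)/4 + 1` for the `(+,+)` type and `(5^m − 1)/4` otherwise;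
consequently the total dimension of the eigenspaces of each symmetry type is the same. -/
theorem symmetry_types (m : ℕ) (hm : 1 ≤ m) (e1 e2 : ℝ)
    (he1 : e1 = 1 ∨ e1 = -1) (he2 : e2 = 1 ∨ e2 = -1) :
    (∀ u ∈ symSub m e1 e2, lap m u ∈ symSub m e1 e2) ∧
    Module.finrank ℝ ↥(symSub m e1 e2) =
      (if e1 = 1 ∧ e2 = 1 then (5 ^ m - 1) / 4 + 1 else (5 ^ m - 1) / 4) ∧
    Module.finrank ℝ ↥(⨆ lam : ℝ, eigensp m lam ⊓ symSub m e1 e2) =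
      (if e1 = 1 ∧ e2 = 1 then (5 ^ m - 1) / 4 + 1 else (5 ^ m - 1) / 4) := by
  have h1 : e1 * e1 = 1 := by rcases he1 with rfl | rfl <;> norm_num
  have h2 : e2 * e2 = 1 := by rcases he2 with rfl | rfl <;> norm_num
  have hdim : Module.finrank ℝ (symSub m e1 e2) =
      (if e1 = 1 ∧ e2 = 1 then (5 ^ m - 1) / 4 + 1 else (5 ^ m - 1) / 4) := by
    have h := finrank_symSub (m := m) h1 h2
    have hpos : 0 < 5 ^ m := by positivity
    split_ifs with hc
    · obtain ⟨rfl, rfl⟩ := hc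
      have h' : 4 * Module.finrank ℝ (symSub m 1 1) = 5 ^ m + 3 := by
        rify; linarith
      omega
    · have h' : 4 * Module.finrank ℝ (symSub m e1 e2) + 1 = 5 ^ m := by
        rify
        rcases he1 with rfl | rfl <;> rcases he2 with rfl | rfl
        · exact absurd ⟨rfl, rfl⟩ hc
        all_goals linarith
      omega
  refine ⟨fun u => lap_mem_symSub, hdim, ?_⟩
  rw [iSup_eigensp_inf_symSub, hdim]

end VNLE
end
end
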